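/- arXiv:2507.10395 — 2 statements merged into one kernel-verified Lean document; each statement's English description precedes it below -/
import Mathlib

section
/- Let C₂ ⊆ C₁ ⊆ 𝔽₂ⁿ be binary linear codes with k = dim C₁ - dim C₂, such that every element of C₁ \ C₂ has Hamming weight ≥ d and every element of C₂^⊥ \ C₁^⊥ has Hamming weight ≥ d (i.e., (C₁, C₂) defines an [[n,k,≥d]] CSS code). Let φ : 𝔽₂ⁿ → 𝔽₂^{2n} be the doubling map with φ(c)_{2j-1} = φ(c)_{2j} = c_j, and let y' ∈ 𝔽₂^{2n} be the vector with y'_{2j-1} = 0 and y'_{2j} = 1 for all j. Then the triple (φ(C₁), φ(C₂), y') defines a [[2n, k, ≥d]] n-CE CSS code; explicitly: (1) φ(C₂) ⊆ φ(C₁) ⊆ 𝔽₂^{2n} are linear codes with dim φ(C₁) - dim φ(C₂) = k; (2) every element of y' + φ(C₁) has Hamming weight exactly n; (3) every element of φ(C₁) \ φ(C₂) has Hamming weight ≥ d; and (4) every element of φ(C₂)^⊥ \ φ(C₁)^⊥ has Hamming weight ≥ d. -/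
/-- The dual code of `C`: all vectors orthogonal to every codeword of `C` with
respect to the standard bilinear form over `𝔽₂`. -/
def dualCode {m : ℕ} (C : Submodule (ZMod 2) (Fin m → ZMod 2)) :
    Set (Fin m → ZMod 2) :=
  {x | ∀ c ∈ C, ∑ i, x i * c i = 0}

/-- The doubling map `φ : 𝔽₂ⁿ → 𝔽₂^{2n}`, `φ(c)_{2j-1} = φ(c)_{2j} = c_j`
(coordinates grouped into consecutive pairs), corresponding to concatenation
with the dual-rail code. -/
def doubling (n : ℕ) : (Fin n → ZMod 2) →ₗ[ZMod 2] (Fin (2 * n) → ZMod 2) where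
  toFun c := fun j => c ⟨j.val / 2, by omega⟩
  map_add' := fun _ _ => rfl
  map_smul' := fun _ _ => rfl

/-- The shift vector `y' ∈ 𝔽₂^{2n}` with `y'_{2j-1} = 0` and `y'_{2j} = 1` for
each pair `(2j-1, 2j)` (0-indexed: `1` exactly on odd positions). -/
def shiftY (n : ℕ) : Fin (2 * n) → ZMod 2 :=
  fun j => if j.val % 2 = 1 then 1 else 0

theorem sum_pairs {M : Type*} [AddCommMonoid M] (n : ℕ) (f : Fin (2 * n) → M) :
    ∑ i, f i = ∑ j : Fin n, (f ⟨2 * j.val, by omega⟩ + f ⟨2 * j.val + 1, by omega⟩) := by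
  induction n with
  | zero => rfl
  | succ n ih =>
    rw [Fin.sum_univ_castSucc (n := n)]
    have h := Fin.sum_univ_castSucc (n := 2 * n + 1) f
    rw [Fin.sum_univ_castSucc (n := 2 * n)] at h
    refine h.trans ?_
    rw [ih, add_assoc]
    rfl

theorem hammingNorm_pairs (n : ℕ) (v : Fin (2 * n) → ZMod 2) :
    hammingNorm v = ∑ j : Fin n, ((if v ⟨2 * j.val, by omega⟩ ≠ 0 then 1 else 0)
      + (if v ⟨2 * j.val + 1, by omega⟩ ≠ 0 then 1 else 0)) := by
  unfold hammingNorm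
  rw [Finset.card_filter, sum_pairs]

theorem doubling_even (n : ℕ) (c : Fin n → ZMod 2) (j : Fin n) :
    doubling n c ⟨2 * j.val, by omega⟩ = c j := by
  change c _ = c j
  congr 1
  ext
  change 2 * j.val / 2 = j.val
  omega

theorem doubling_odd (n : ℕ) (c : Fin n → ZMod 2) (j : Fin n) :
    doubling n c ⟨2 * j.val + 1, by omega⟩ = c j := by
  change c _ = c j
  congr 1
  ext
  change (2 * j.val + 1) / 2 = j.val
  omega

theorem doubling_inj (n : ℕ) : Function.Injective (doubling n) := by
  intro a b h
  ext1 j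
  rw [← doubling_even n a j, h, doubling_even]

theorem dual_pairs (n : ℕ) (C : Submodule (ZMod 2) (Fin n → ZMod 2))
    (x : Fin (2 * n) → ZMod 2) :
    x ∈ dualCode (Submodule.map (doubling n) C) ↔
      (fun j : Fin n => x ⟨2 * j.val, by omega⟩ + x ⟨2 * j.val + 1, by omega⟩) ∈ dualCode C := by
  simp only [dualCode, Set.mem_setOf_eq, Submodule.mem_map, forall_exists_index, and_imp,
    forall_apply_eq_imp_iff₂, sum_pairs, doubling_even, doubling_odd, add_mul]

/-- Dual-rail concatenation of an `[[n,k,≥d]]` CSS code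
`(C₁, C₂)` yields a `[[2n, k, ≥d]]` `n`-CE CSS code `(φ(C₁), φ(C₂), y')`. -/
theorem dual_rail_concatenation_CE_CSS (n k d : ℕ)
    (C₁ C₂ : Submodule (ZMod 2) (Fin n → ZMod 2))
    (hsub : C₂ ≤ C₁)
    (hk : k = Module.finrank (ZMod 2) C₁ - Module.finrank (ZMod 2) C₂)
    (hd₁ : ∀ v ∈ C₁, v ∉ C₂ → d ≤ hammingNorm v)
    (hd₂ : ∀ x ∈ dualCode C₂, x ∉ dualCode C₁ → d ≤ hammingNorm x) :
    (Submodule.map (doubling n) C₂ ≤ Submodule.map (doubling n) C₁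
        ∧ Module.finrank (ZMod 2) (Submodule.map (doubling n) C₁)
            - Module.finrank (ZMod 2) (Submodule.map (doubling n) C₂) = k)
      ∧ (∀ v ∈ Submodule.map (doubling n) C₁, hammingNorm (shiftY n + v) = n)
      ∧ (∀ v ∈ Submodule.map (doubling n) C₁,
          v ∉ Submodule.map (doubling n) C₂ → d ≤ hammingNorm v)
      ∧ (∀ x ∈ dualCode (Submodule.map (doubling n) C₂),
          x ∉ dualCode (Submodule.map (doubling n) C₁) → d ≤ hammingNorm x) := by
  refine ⟨⟨Submodule.map_mono hsub, ?_⟩, ?_, ?_, ?_⟩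
  · have h : ∀ C : Submodule (ZMod 2) (Fin n → ZMod 2),
        Module.finrank (ZMod 2) (Submodule.map (doubling n) C) = Module.finrank (ZMod 2) C :=
      fun C => (Submodule.equivMapOfInjective _ (doubling_inj n) C).finrank_eq.symm
    rw [h, h, hk]
  · rintro _ ⟨c, _, rfl⟩
    rw [hammingNorm_pairs]
    have key : ∀ a : ZMod 2, ((if (0 + a) ≠ 0 then 1 else 0)
      + (if (1 + a) ≠ 0 then 1 else 0) : ℕ) = 1 := by decide
    have h0 : ∀ j : Fin n, shiftY n ⟨2 * j.val, by omega⟩ = 0 := by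
      intro j; simp [shiftY]
    have h1 : ∀ j : Fin n, shiftY n ⟨2 * j.val + 1, by omega⟩ = 1 := by
      intro j; simp [shiftY, Nat.add_mod]
    simp only [Pi.add_apply, doubling_even, doubling_odd, h0, h1, key]
    simp
  · rintro _ ⟨c, hc, rfl⟩ hn
    refine (hd₁ c hc fun h => hn ⟨c, h, rfl⟩).trans ?_
    rw [hammingNorm_pairs]
    unfold hammingNorm
    rw [Finset.card_filter]
    refine Finset.sum_le_sum fun j _ => ?_
    rw [doubling_even, doubling_odd]
    exact Nat.le_add_right _ _
  · intro x hx hx'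
    rw [dual_pairs] at hx hx'
    refine (hd₂ _ hx hx').trans ?_
    rw [hammingNorm_pairs]
    unfold hammingNorm
    rw [Finset.card_filter]
    refine Finset.sum_le_sum fun j _ => ?_
    have key : ∀ a b : ZMod 2, ((if a + b ≠ 0 then 1 else 0) : ℕ) ≤
      (if a ≠ 0 then 1 else 0) + (if b ≠ 0 then 1 else 0) := by decide
    exact key _ _
end

section
/- There exists a [[12,1,3]] 6-CE CSS code: there are binary linear codes C₂ ⊆ C₁ ⊆ 𝔽₂¹² with dim C₂ = 4 and dim C₁ = 5, and a vector y ∈ 𝔽₂¹², such that every element of y + C₁ has Hamming weight exactly 6, every element of C₁ \ C₂ has Hamming weight ≥ 3, and every element of C₂^⊥ \ C₁^⊥ has Hamming weight ≥ 3. Explicitly, one may take C₂ spanned by the supports of X₁X₂X₃X₄, X₃X₄X₅X₆, X₇X₈X₉X₁₀, X₉X₁₀X₁₁X₁₂, C₁ = C₂ + span of the support of X₅X₆X₁₁X₁₂, and y = (0,1,0,1,0,1,0,1,0,1,0,1). -/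
/-- The encoder whose range is `C₁` : the parameters give the values on six pairs of qubits. -/
def enc1 : (Fin 5 → ZMod 2) →ₗ[ZMod 2] (Fin 12 → ZMod 2) where
  toFun a := ![a 0, a 0, a 0 + a 1, a 0 + a 1, a 1 + a 4, a 1 + a 4,
    a 2, a 2, a 2 + a 3, a 2 + a 3, a 3 + a 4, a 3 + a 4]
  map_add' a b := by
    ext i; fin_cases i <;> simp <;> ring
  map_smul' r a := by
    ext i; fin_cases i <;> simp <;> ring

/-- The inclusion of the parameters of `C₂` into those of `C₁`. -/
def inc : (Fin 4 → ZMod 2) →ₗ[ZMod 2] (Fin 5 → ZMod 2) where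
  toFun a := ![a 0, a 1, a 2, a 3, 0]
  map_add' a b := by
    ext i; fin_cases i <;> simp
  map_smul' r a := by
    ext i; fin_cases i <;> simp

lemma enc1_apply (a : Fin 5 → ZMod 2) :
    enc1 a = ![a 0, a 0, a 0 + a 1, a 0 + a 1, a 1 + a 4, a 1 + a 4,
    a 2, a 2, a 2 + a 3, a 2 + a 3, a 3 + a 4, a 3 + a 4] := rfl

lemma inc_apply (a : Fin 4 → ZMod 2) : inc a = ![a 0, a 1, a 2, a 3, 0] := rfl

lemma hammingNorm_eq (x : Fin 12 → ZMod 2) :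
    hammingNorm x = ∑ i, if x i ≠ 0 then 1 else 0 := by
  rw [hammingNorm, Finset.card_filter]

lemma enc1_inj : Function.Injective enc1 := by
  rw [injective_iff_map_eq_zero]
  intro a h
  have h0 := congrFun h 0
  have h2 := congrFun h 2
  have h4 := congrFun h 4
  have h6 := congrFun h 6
  have h8 := congrFun h 8
  simp [enc1_apply] at h0 h2 h4 h6 h8
  simp_all
  ext i; fin_cases i <;> simp_all

lemma inc_inj : Function.Injective inc := by
  intro a b h
  have h0 := congrFun h 0
  have h1 := congrFun h 1
  have h2 := congrFun h 2
  have h3 := congrFun h 3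
  simp [inc_apply] at h0 h1 h2 h3
  ext i; fin_cases i <;> simp_all

lemma wt_shift : ∀ p q r s t u : ZMod 2,
    hammingNorm ((![0, 1, 0, 1, 0, 1, 0, 1, 0, 1, 0, 1] : Fin 12 → ZMod 2) +
      ![p, p, q, q, r, r, s, s, t, t, u, u]) = 6 := by
  decide +kernel

lemma pair_wt : ∀ a b : ZMod 2, a + b = 1 →
    1 ≤ (if a ≠ 0 then 1 else 0) + (if b ≠ 0 then 1 else 0) := by
  decide

lemma wt_block (x : Fin 12 → ZMod 2)
    (h : (x 0 + x 1 = 1 ∧ x 2 + x 3 = 1 ∧ x 4 + x 5 = 1) ∨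
      (x 6 + x 7 = 1 ∧ x 8 + x 9 = 1 ∧ x 10 + x 11 = 1)) : 3 ≤ hammingNorm x := by
  rw [hammingNorm_eq]
  have e : ∀ f : Fin 12 → ℕ, ∑ i, f i = f 0 + f 1 + f 2 + f 3 + f 4 + f 5 + f 6 + f 7 + f 8
      + f 9 + f 10 + f 11 := by
    intro f
    simp [Fin.sum_univ_succ, add_assoc]
  rw [e]
  rcases h with ⟨h1, h2, h3⟩ | ⟨h1, h2, h3⟩ <;>
  · have := pair_wt _ _ h1
    have := pair_wt _ _ h2
    have := pair_wt _ _ h3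
    omega

lemma wt_code : ∀ a : Fin 5 → ZMod 2, a 4 ≠ 0 → 3 ≤ hammingNorm (enc1 a) := by
  have : ∀ p q r s t : ZMod 2, t ≠ 0 → 3 ≤ hammingNorm (![p, p, p + q, p + q, q + t, q + t,
    r, r, r + s, r + s, s + t, s + t] : Fin 12 → ZMod 2) := by
    decide +kernel
  intro a
  rw [enc1_apply]
  exact this _ _ _ _ _

lemma parity_aux : ∀ a b c d e f : ZMod 2, a + b = 0 → b + c = 0 → d + e = 0 → e + f = 0 →
    c + f ≠ 0 → (a = 1 ∧ b = 1 ∧ c = 1) ∨ (d = 1 ∧ e = 1 ∧ f = 1) := by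
  intro a b c d e f
  revert a b c d e f
  set_option synthInstance.maxSize 100000 in
  set_option synthInstance.maxHeartbeats 400000 in
  decide +kernel

lemma dot_enc1 (x : Fin 12 → ZMod 2) (a : Fin 5 → ZMod 2) :
    ∑ i, x i * enc1 a i = a 0 * ((x 0 + x 1) + (x 2 + x 3)) + a 1 * ((x 2 + x 3) + (x 4 + x 5))
      + a 2 * ((x 6 + x 7) + (x 8 + x 9)) + a 3 * ((x 8 + x 9) + (x 10 + x 11))
      + a 4 * ((x 4 + x 5) + (x 10 + x 11)) := by
  have e : ∀ f : Fin 12 → ZMod 2, ∑ i, f i = f 0 + f 1 + f 2 + f 3 + f 4 + f 5 + f 6 + f 7 + f 8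
      + f 9 + f 10 + f 11 := by
    intro f
    simp [Fin.sum_univ_succ, add_assoc]
  rw [e, enc1_apply]
  simp
  ring


/-- The indicator vector in `𝔽₂¹²` of a set of qubits (1-indexed). -/
def indic (s : Finset (Fin 12)) : Fin 12 → ZMod 2 := fun i => if i ∈ s then 1 else 0

/-- There exists a `[[12,1,3]]` `6`-CE CSS code: linear codes
`C₂ ⊆ C₁ ⊆ 𝔽₂¹²` with `dim C₂ = 4`, `dim C₁ = 5` and a shift `y` such that every
element of `y + C₁` has Hamming weight exactly `6`, every element of `C₁ \ C₂`
has Hamming weight `≥ 3`, and every element of `C₂^⊥ \ C₁^⊥` has Hamming weight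
`≥ 3`.  (Explicitly, one may take `C₂` spanned by the supports of
`X₁X₂X₃X₄, X₃X₄X₅X₆, X₇X₈X₉X₁₀, X₉X₁₀X₁₁X₁₂`, `C₁ = C₂ +` the span of the
support of `X₅X₆X₁₁X₁₂`, and `y = (0,1,0,1,0,1,0,1,0,1,0,1)`.) -/
theorem exists_12_1_3_CE_CSS_code :
    ∃ (C₁ C₂ : Submodule (ZMod 2) (Fin 12 → ZMod 2)) (y : Fin 12 → ZMod 2),
      C₂ ≤ C₁
      ∧ Module.finrank (ZMod 2) C₂ = 4
      ∧ Module.finrank (ZMod 2) C₁ = 5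
      ∧ (∀ v ∈ C₁, hammingNorm (y + v) = 6)
      ∧ (∀ v ∈ C₁, v ∉ C₂ → 3 ≤ hammingNorm v)
      ∧ (∀ x ∈ dualCode C₂, x ∉ dualCode C₁ → 3 ≤ hammingNorm x) := by
  refine ⟨LinearMap.range enc1, LinearMap.range (enc1 ∘ₗ inc),
    ![0, 1, 0, 1, 0, 1, 0, 1, 0, 1, 0, 1], ?_, ?_, ?_, ?_, ?_, ?_⟩
  · exact LinearMap.range_comp_le_range _ _
  · rw [LinearMap.finrank_range_of_inj (by exact enc1_inj.comp inc_inj)]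
    simp
  · rw [LinearMap.finrank_range_of_inj enc1_inj]
    simp
  · rintro _ ⟨a, rfl⟩
    rw [enc1_apply]
    exact wt_shift _ _ _ _ _ _
  · rintro _ ⟨a, rfl⟩ hv
    apply wt_code
    intro h4
    apply hv
    refine ⟨![a 0, a 1, a 2, a 3], ?_⟩
    rw [LinearMap.comp_apply]
    congr 1
    rw [inc_apply]
    ext i; fin_cases i <;> simp [h4]
  · intro x hx hx1
    have hd : ∀ a : Fin 4 → ZMod 2, ∑ i, x i * enc1 (inc a) i = 0 := fun a => hx _ ⟨a, rfl⟩
    have g0 := hd ![1, 0, 0, 0]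
    have g1 := hd ![0, 1, 0, 0]
    have g2 := hd ![0, 0, 1, 0]
    have g3 := hd ![0, 0, 0, 1]
    rw [dot_enc1, inc_apply] at g0 g1 g2 g3
    simp only [Matrix.cons_val, one_mul, zero_mul, add_zero, zero_add] at g0 g1 g2 g3
    apply wt_block
    apply parity_aux _ _ _ _ _ _ g0 g1 g2 g3
    intro g4
    apply hx1
    rintro _ ⟨a, rfl⟩
    rw [dot_enc1, g0, g1, g2, g3, g4]
    simp
end
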